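/- Let s₁, s₂ > 0 be such that s₁·s₂/2 is a positive integer, let ℓ ≥ 2 be an even integer, and define H : ℝ → ℝ by H(f) := ((sinc_{s₁})^ℓ * rect_{s₂})(f). Then for every f with 0 ≤ f ≤ s₂/4 one has 0 ≤ H(0) − H(f) ≤ (f/s₂) · (π · s₁ · s₂ / 4)^{-ℓ}. -/

import Mathlib

open Real MeasureTheory

/-- `sincs s t = sin(π s t)/(π s t)` for `t ≠ 0`, and `sincs s 0 = 1`. -/
noncomputable def sincs (s t : ℝ) : ℝ := if t = 0 then 1 else Real.sin (π * s * t) / (π * s * t)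

/-- `rects s f = 1/s` if `|f| ≤ s/2`, and `0` otherwise. -/
noncomputable def rects (s f : ℝ) : ℝ := if |f| ≤ s / 2 then 1 / s else 0

lemma sincs_eq (s t : ℝ) (hs : 0 < s) : sincs s t = Real.sinc (π * s * t) := by
  unfold sincs Real.sinc
  have : π * s * t = 0 ↔ t = 0 := by
    have := Real.pi_pos.ne'
    have := hs.ne'
    simp [*]
  simp [this]

lemma conv_eq (g : ℝ → ℝ) (s f : ℝ) (hs : 0 < s) :
    (∫ τ : ℝ, g τ * rects s (f - τ)) = (1 / s) * ∫ τ in (f - s/2)..(f + s/2), g τ := by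
  rw [intervalIntegral.integral_of_le (by linarith), ← integral_Icc_eq_integral_Ioc,
    ← integral_indicator measurableSet_Icc, ← integral_const_mul]
  congr 1
  ext τ
  unfold rects
  by_cases h : |f - τ| ≤ s / 2
  · have h2 := abs_le.1 h
    have : τ ∈ Set.Icc (f - s/2) (f + s/2) := ⟨by linarith, by linarith⟩
    rw [if_pos h, Set.indicator_of_mem this, mul_comm]
  · have : τ ∉ Set.Icc (f - s/2) (f + s/2) := fun h2 =>
      h (abs_le.2 ⟨by linarith [h2.2], by linarith [h2.1]⟩)
    rw [if_neg h, Set.indicator_of_notMem this, mul_zero, mul_zero]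

theorem stmt_3 (s₁ s₂ : ℝ) (hs₁ : 0 < s₁) (hs₂ : 0 < s₂)
    (hint : ∃ n : ℕ, 0 < n ∧ s₁ * s₂ / 2 = (n : ℝ))
    (ℓ : ℕ) (hev : Even ℓ) (hℓ : 2 ≤ ℓ)
    (f : ℝ) (hf0 : 0 ≤ f) (hf : f ≤ s₂ / 4) :
    0 ≤ (∫ τ : ℝ, (sincs s₁ τ) ^ ℓ * rects s₂ (0 - τ)) -
        (∫ τ : ℝ, (sincs s₁ τ) ^ ℓ * rects s₂ (f - τ)) ∧
    (∫ τ : ℝ, (sincs s₁ τ) ^ ℓ * rects s₂ (0 - τ)) -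
        (∫ τ : ℝ, (sincs s₁ τ) ^ ℓ * rects s₂ (f - τ)) ≤
      (f / s₂) * ((π * s₁ * s₂ / 4) ^ ℓ)⁻¹ := by
  obtain ⟨n, hn, hn2⟩ := hint
  have hpi := Real.pi_pos
  rw [conv_eq (fun τ => sincs s₁ τ ^ ℓ) s₂ 0 hs₂, conv_eq (fun τ => sincs s₁ τ ^ ℓ) s₂ f hs₂]
  set g : ℝ → ℝ := fun τ => sincs s₁ τ ^ ℓ with hg
  have hc : Continuous g := by
    have : g = fun τ => Real.sinc (π * s₁ * τ) ^ ℓ := by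
      ext τ; simp only [hg, sincs_eq _ _ hs₁]
    rw [this]
    exact (Real.continuous_sinc.comp (continuous_const.mul continuous_id)).pow ℓ
  have heven : ∀ t, g (-t) = g t := by
    intro t
    simp only [hg, sincs_eq _ _ hs₁, mul_neg, Real.sinc_neg]
  have hi : ∀ a b, IntervalIntegrable g volume a b := fun a b => hc.intervalIntegrable a b
  have hg0 : ∀ t, 0 ≤ g t := fun t => hev.pow_nonneg _
  have hpos : ∀ t, 0 < t → g t = |Real.sin (π * s₁ * t)| ^ ℓ / (π * s₁ * t) ^ ℓ := by
    intro t ht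
    simp only [hg, sincs, if_neg ht.ne', div_pow, hev.pow_abs]
  have key : (∫ τ in (0 - s₂/2)..(0 + s₂/2), g τ) - (∫ τ in (f - s₂/2)..(f + s₂/2), g τ)
      = ∫ u in (0:ℝ)..f, (g (s₂/2 - u) - g (u + s₂/2)) := by
    have i1 : IntervalIntegrable (fun u => g (s₂/2 - u)) volume 0 f :=
      Continuous.intervalIntegrable (by fun_prop) _ _
    have i2 : IntervalIntegrable (fun u => g (u + s₂/2)) volume 0 f :=
      Continuous.intervalIntegrable (by fun_prop) _ _
    rw [intervalIntegral.integral_sub i1 i2]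
    rw [intervalIntegral.integral_comp_add_right (fun x => g x)]
    have : (∫ u in (0:ℝ)..f, g (s₂/2 - u)) = ∫ u in (0 - s₂/2)..(f - s₂/2), g u := by
      rw [← intervalIntegral.integral_comp_sub_right (fun x => g x)]
      congr 1
      ext u
      rw [← heven, neg_sub]
    rw [this]
    have h1 := intervalIntegral.integral_add_adjacent_intervals
      (hi (0 - s₂/2) (f - s₂/2)) (hi (f - s₂/2) (0 + s₂/2))
    have h2 := intervalIntegral.integral_add_adjacent_intervals
      (hi (f - s₂/2) (0 + s₂/2)) (hi (0 + s₂/2) (f + s₂/2))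
    linarith
  have hsin : ∀ u, |Real.sin (π * s₁ * (s₂/2 - u))| = |Real.sin (π * s₁ * (u + s₂/2))| := by
    intro u
    have e1 : π * s₁ * (s₂/2 - u) = n * π - π * s₁ * u := by rw [← hn2]; ring
    have e2 : π * s₁ * (u + s₂/2) = π * s₁ * u + n * π := by rw [← hn2]; ring
    rw [e1, e2, Real.sin_nat_mul_pi_sub, Real.sin_add_nat_mul_pi, abs_neg]
  have hci : IntervalIntegrable (fun u => g (s₂/2 - u) - g (u + s₂/2)) volume 0 f :=
    ((hc.comp (continuous_const.sub continuous_id)).sub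
      (hc.comp (continuous_id.add continuous_const))).intervalIntegrable _ _
  rw [← mul_sub, key]
  constructor
  · apply mul_nonneg (by positivity)
    apply intervalIntegral.integral_nonneg hf0
    intro u hu
    have h1 : 0 < s₂/2 - u := by linarith [hu.2]
    have h2 : 0 < u + s₂/2 := by linarith [hu.1]
    rw [hpos _ h1, hpos _ h2, hsin, sub_nonneg]
    have : s₂/2 - u ≤ u + s₂/2 := by linarith [hu.1]
    gcongr
  · have hb : (∫ u in (0:ℝ)..f, (g (s₂/2 - u) - g (u + s₂/2)))
        ≤ ∫ u in (0:ℝ)..f, ((π * s₁ * s₂ / 4) ^ ℓ)⁻¹ := by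
      apply intervalIntegral.integral_mono_on hf0 hci intervalIntegrable_const
      intro u hu
      have h1 : 0 < s₂/2 - u := by linarith [hu.2]
      have h3 : π * s₁ * s₂ / 4 ≤ π * s₁ * (s₂/2 - u) := by
        rw [mul_div_assoc]; gcongr; linarith [hu.2]
      have : g (s₂/2 - u) ≤ ((π * s₁ * s₂ / 4) ^ ℓ)⁻¹ := by
        rw [hpos _ h1, ← one_div]
        have h4 : |Real.sin (π * s₁ * (s₂/2 - u))| ^ ℓ ≤ 1 :=
          pow_le_one₀ (abs_nonneg _) (Real.abs_sin_le_one _)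
        gcongr
      linarith [hg0 (u + s₂/2)]
    rw [intervalIntegral.integral_const, smul_eq_mul, sub_zero] at hb
    calc _ ≤ 1 / s₂ * (f * ((π * s₁ * s₂ / 4) ^ ℓ)⁻¹) := by gcongr
      _ = _ := by ring
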